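/- Let T be a d-angulation of a convex n-gon. Define numbers m̃_{i,j} inductively: m̃_{i,i} = 0; m̃_{i,j} = 1 whenever i and j lie on a common d-gon of T; and if α is a d-gon of T with vertices k and ℓ already assigned values m̃_{i,k}, m̃_{i,ℓ}, then every other vertex v of α is assigned m̃_{i,v} = m̃_{i,k} + m̃_{i,ℓ}. Then m̃_{i,j} equals the number m_{i,j} of d-paths from i to j, for all vertices i, j. -/

import Mathlib

noncomputable section

/-- The `k`-th vertex of a regular `n`-gon inscribed in the unit circle. -/
def vtx (n : ℕ) (k : ZMod n) : ℝ × ℝ :=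
  (Real.cos (2 * Real.pi * k.val / n), Real.sin (2 * Real.pi * k.val / n))

/-- The convex hull spanned by a set `c` of vertices of the `n`-gon. -/
def cellHull (n : ℕ) (c : Finset (ZMod n)) : Set (ℝ × ℝ) :=
  convexHull ℝ (vtx n '' (c : Set (ZMod n)))

/-- `T` is a `d`-angulation of the convex `n`-gon: a dissection of the polygon by
pairwise non-crossing diagonals into `d`-gon cells.  Each cell is recorded by its
vertex set; the cells cover the polygon and have pairwise disjoint interiors. -/
def IsDAngulation (n d : ℕ) (T : Finset (Finset (ZMod n))) : Prop :=
  (∀ c ∈ T, c.card = d) ∧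
  (⋃ c ∈ T, cellHull n c) = convexHull ℝ (Set.range (vtx n)) ∧
  ∀ c ∈ T, ∀ c' ∈ T, c ≠ c' →
    interior (cellHull n c) ∩ interior (cellHull n c') = ∅

/-- The number of vertices strictly between `i` and `j`, going counterclockwise. -/
def pathLen (n : ℕ) (i j : ZMod n) : ℕ := (j - i - 1).val

/-- A (counterclockwise) `d`-path from `i` to `j` in the `d`-angulation `T`:
a sequence `p_{i+1}, …, p_{j-1}` of cells of `T`, indexed by the vertices
encountered going counterclockwise from `i` to `j`, such that the cell at
position `k` is incident to the vertex `i+1+k`, and each cell of `T` occurs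
at most `d - 2` times in the sequence. -/
def IsDPath (n d : ℕ) (T : Finset (Finset (ZMod n))) (i j : ZMod n)
    (q : Fin (pathLen n i j) → {c // c ∈ T}) : Prop :=
  (∀ k, (i + 1 + ((k : ℕ) : ZMod n)) ∈ (q k : Finset (ZMod n))) ∧
  ∀ c ∈ T, (Finset.univ.filter (fun k => (q k : Finset (ZMod n)) = c)).card ≤ d - 2

/-- The number `m_{i,j}` of counterclockwise `d`-paths from `i` to `j`. -/
def dPathCount (n d : ℕ) (T : Finset (Finset (ZMod n))) (i j : ZMod n) : ℕ :=
  Nat.card {q : Fin (pathLen n i j) → {c // c ∈ T} // IsDPath n d T i j q}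

/-- `v` lies on the closed counterclockwise arc from `a` to `b`. -/
def InArc (n : ℕ) (a b v : ZMod n) : Prop := (v - a).val ≤ (b - a).val

/-- `a` and `b` are endpoints of a side of the cell `c`: a pair of distinct vertices
of `c` such that one of the two arcs between `a` and `b` contains no further
vertex of `c`. -/
def IsCellEdge (n : ℕ) (c : Finset (ZMod n)) (a b : ZMod n) : Prop :=
  a ∈ c ∧ b ∈ c ∧ a ≠ b ∧
  ((∀ v ∈ c, InArc n a b v → v = a ∨ v = b) ∨
   (∀ v ∈ c, InArc n b a v → v = a ∨ v = b))

/-- The unordered pair `z` is a side of the cell `c`. -/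
def SideOf (n : ℕ) (c : Finset (ZMod n)) (z : Sym2 (ZMod n)) : Prop :=
  ∃ a b, z = s(a, b) ∧ IsCellEdge n c a b

/-- `z` is a boundary edge of the `n`-gon (joining consecutive vertices). -/
def IsBoundaryEdge (n : ℕ) (z : Sym2 (ZMod n)) : Prop := ∃ a, z = s(a, a + 1)

/-- `z` is a diagonal used in the `d`-angulation `T`: a side of some cell that is
not a boundary edge of the polygon. -/
def IsDiagonal (n : ℕ) (T : Finset (Finset (ZMod n))) (z : Sym2 (ZMod n)) : Prop :=
  (∃ c ∈ T, SideOf n c z) ∧ ¬ IsBoundaryEdge n z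

/-- Combinatorial shadow of a `d`-angulation of a polygon with vertices `0, …, n - 1`:
pairwise distinct non-crossing `d`-sets such that `{0, n - 1}` lies in some cell and every pair
`a + 1 < b` of vertices of a cell lies in a cell having a further vertex between `a` and `b`. -/
structure IsNoncrossing {ι : Type*} (n d : ℕ) (cell : ι → Finset ℕ) : Prop where
  three_le : 3 ≤ d
  card_cell : ∀ t, (cell t).card = d
  inj : Function.Injective cell
  lt_of_mem : ∀ t, ∀ x ∈ cell t, x < n
  not_cross : ∀ s t, s ≠ t → ∀ a ∈ cell s, ∀ x ∈ cell t, ∀ b ∈ cell s, ∀ y ∈ cell t,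
    a < x → x < b → b < y → False
  exists_between : ∀ s, ∀ a ∈ cell s, ∀ b ∈ cell s, a + 1 < b →
    ∃ t, a ∈ cell t ∧ b ∈ cell t ∧ ∃ z ∈ cell t, a < z ∧ z < b
  exists_base : ∃ t, 0 ∈ cell t ∧ n - 1 ∈ cell t

/-- The elements of `s` other than its minimum and maximum. -/
def innerPart (s : Finset ℕ) : Finset ℕ := {x ∈ s | (∃ a ∈ s, a < x) ∧ ∃ b ∈ s, x < b}

theorem mem_innerPart {s : Finset ℕ} {x : ℕ} :
    x ∈ innerPart s ↔ x ∈ s ∧ (∃ a ∈ s, a < x) ∧ ∃ b ∈ s, x < b := by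
  simp [innerPart]

theorem card_innerPart {s : Finset ℕ} (hs : 2 ≤ s.card) : (innerPart s).card = s.card - 2 := by
  have hne : s.Nonempty := Finset.card_pos.1 (by omega)
  have hlt : s.min' hne < s.max' hne := Finset.min'_lt_max'_of_card s (by omega)
  have : innerPart s = (s.erase (s.min' hne)).erase (s.max' hne) := by
    ext x
    simp only [mem_innerPart, Finset.mem_erase]
    constructor
    · rintro ⟨hx, ⟨a, ha, hax⟩, b, hb, hxb⟩
      have h1 := s.min'_le a ha
      have h2 := s.le_max' b hb
      exact ⟨by omega, by omega, hx⟩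
    · rintro ⟨h1, h2, hx⟩
      have h3 := s.min'_le x hx
      have h4 := s.le_max' x hx
      exact ⟨hx, ⟨_, s.min'_mem hne, by omega⟩, _, s.max'_mem hne, by omega⟩
  rw [this, Finset.card_erase_of_mem, Finset.card_erase_of_mem (s.min'_mem hne)]
  · omega
  · exact Finset.mem_erase.2 ⟨hlt.ne', s.max'_mem hne⟩

/-- `f` assigns to each `x` with `0 < x < J` a cell containing `x`, each cell being used at most
`d - 2` times. -/
def IsAssignment {ι : Type*} (d : ℕ) (cell : ι → Finset ℕ) (J : ℕ) (f : ℕ → ι) : Prop :=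
  (∀ x ∈ Finset.Ioo 0 J, x ∈ cell (f x)) ∧
    ∀ t, ∀ S : Finset ℕ, S ⊆ Finset.Ioo 0 J → (∀ x ∈ S, f x = t) → S.card ≤ d - 2

/-- The assignments on `0 < x < J`, extended by `g` outside this range. -/
def assignments {ι : Type*} (d : ℕ) (cell : ι → Finset ℕ) (g : ℕ → ι) (J : ℕ) : Set (ℕ → ι) :=
  {f | IsAssignment d cell J f ∧ ∀ x, x ∉ Finset.Ioo 0 J → f x = g x}

theorem IsAssignment.mono {ι : Type*} {d J J' : ℕ} {cell : ι → Finset ℕ} {f : ℕ → ι}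
    (hf : IsAssignment d cell J f) (h : J' ≤ J) : IsAssignment d cell J' f :=
  have hsub : Finset.Ioo 0 J' ⊆ Finset.Ioo 0 J := Finset.Ioo_subset_Ioo_right h
  ⟨fun x hx => hf.1 x (hsub hx), fun t S hS => hf.2 t S (hS.trans hsub)⟩

namespace IsNoncrossing

variable {ι : Type*} {n d : ℕ} {cell : ι → Finset ℕ}

theorem card_innerPart_cell (h : IsNoncrossing n d cell) (t : ι) :
    (innerPart (cell t)).card = d - 2 := by
  have := h.three_le
  rw [card_innerPart (by rw [h.card_cell]; omega), h.card_cell]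

theorem eq_of_mem_innerPart (h : IsNoncrossing n d cell) {s t : ι} {x : ℕ}
    (hs : x ∈ innerPart (cell s)) (ht : x ∈ innerPart (cell t)) : s = t := by
  by_contra hne
  obtain ⟨hxs, ⟨a, ha, hax⟩, b, hb, hxb⟩ := mem_innerPart.1 hs
  obtain ⟨hxt, ⟨a', ha', hax'⟩, b', hb', hxb'⟩ := mem_innerPart.1 ht
  have X := h.not_cross s t hne
  have X' := h.not_cross t s (Ne.symm hne)
  have hb_eq : b = b' := by
    rcases lt_trichotomy b b' with hlt | heq | hlt
    · exact (X a ha x hxt b hb b' hb' hax hxb hlt).elim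
    · exact heq
    · exact (X' a' ha' x hxs b' hb' b hb hax' hxb' hlt).elim
  have ha_eq : a = a' := by
    rcases lt_trichotomy a a' with hlt | heq | hlt
    · exact (X a ha a' ha' x hxs b' hb' hlt hax' hxb').elim
    · exact heq
    · exact (X' a' ha' a ha x hxt b hb hlt hax hxb).elim
  subst hb_eq ha_eq
  have hnot : ¬ cell t ⊆ cell s := fun hsub => hne
    (h.inj (Finset.eq_of_subset_of_card_le hsub (by rw [h.card_cell, h.card_cell]))).symm
  obtain ⟨y, hyt, hys⟩ := Finset.not_subset.1 hnot
  have hya : y ≠ a := fun e => hys (e ▸ ha)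
  have hyx : y ≠ x := fun e => hys (e ▸ hxs)
  have hyb : y ≠ b := fun e => hys (e ▸ hb)
  rcases lt_or_gt_of_ne hya with h1 | h1
  · exact X' y hyt a ha x hxt b hb h1 hax hxb
  rcases lt_or_gt_of_ne hyx with h2 | h2
  · exact X a ha y hyt x hxs b hb' h1 h2 hxb
  rcases lt_or_gt_of_ne hyb with h3 | h3
  · exact X' a ha' x hxs y hyt b hb hax h2 h3
  · exact X a ha x hxt b hb y hyt hax hxb h3

theorem exists_mem_innerPart (h : IsNoncrossing n d cell) {x : ℕ} (hx0 : 0 < x)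
    (hxn : x < n - 1) : ∃ t, x ∈ innerPart (cell t) := by
  have key : ∀ k s a b, b - a = k → a ∈ cell s → b ∈ cell s → a < x → x < b →
      ∃ t, x ∈ innerPart (cell t) := by
    intro k
    induction k using Nat.strong_induction_on with
    | _ k ih =>
      intro s a b hk ha hb hax hxb
      obtain ⟨t, hat, hbt, z, hz, haz, hzb⟩ := h.exists_between s a ha b hb (by omega)
      rcases lt_trichotomy z x with hlt | heq | hlt
      · exact ih (b - z) (by omega) t z b rfl hz hbt hlt hxb
      · exact ⟨t, mem_innerPart.2 ⟨heq ▸ hz, ⟨a, hat, hax⟩, b, hbt, hxb⟩⟩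
      · exact ih (z - a) (by omega) t a z rfl hat hz hax hlt
  obtain ⟨t, h0, h1⟩ := h.exists_base
  exact key _ t 0 (n - 1) rfl h0 h1 hx0 hxn

theorem exists_inner_cell (h : IsNoncrossing n d cell) :
    ∃ g : ℕ → ι, ∀ x, 0 < x → x < n - 1 → x ∈ innerPart (cell (g x)) := by
  classical
  obtain ⟨t₀, -⟩ := h.exists_base
  refine ⟨fun x => if hx : 0 < x ∧ x < n - 1 then (h.exists_mem_innerPart hx.1 hx.2).choose
    else t₀, fun x h0 h1 => ?_⟩
  simp only [h0, h1, and_self, dite_true]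
  exact (h.exists_mem_innerPart h0 h1).choose_spec

theorem pos_lt_of_mem_innerPart (h : IsNoncrossing n d cell) {t : ι} {x : ℕ}
    (hx : x ∈ innerPart (cell t)) : 0 < x ∧ x < n - 1 := by
  obtain ⟨-, ⟨a, -, hax⟩, b, hb, hxb⟩ := mem_innerPart.1 hx
  have := h.lt_of_mem t b hb
  omega

variable {g : ℕ → ι}

theorem eq_inner_of_mem (h : IsNoncrossing n d cell)
    (hg : ∀ x, 0 < x → x < n - 1 → x ∈ innerPart (cell (g x))) {t : ι} {x : ℕ}
    (hx : x ∈ innerPart (cell t)) : g x = t :=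
  have := h.pos_lt_of_mem_innerPart hx
  h.eq_of_mem_innerPart (hg x this.1 this.2) hx

/-- If all inner vertices of `t` are assigned `t`, no other vertex is. -/
theorem ne_of_inner_subset (h : IsNoncrossing n d cell) {J : ℕ} {f : ℕ → ι}
    (hf : IsAssignment d cell J f) {t : ι} {z : ℕ} (hzJ : z ∈ Finset.Ioo 0 J)
    (hz : z ∉ innerPart (cell t)) (hin : innerPart (cell t) ⊆ Finset.Ioo 0 J)
    (heq : ∀ x ∈ innerPart (cell t), f x = t) : f z ≠ t := by
  intro hfz
  have := hf.2 t (insert z (innerPart (cell t)))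
    (Finset.insert_subset hzJ hin) (by simpa [hfz] using heq)
  rw [Finset.card_insert_of_notMem hz, h.card_innerPart_cell] at this
  omega

/-- An assignment is forced strictly between two vertices of a common cell. -/
theorem eq_inner_of_between (h : IsNoncrossing n d cell)
    (hg : ∀ x, 0 < x → x < n - 1 → x ∈ innerPart (cell (g x))) {J : ℕ} {f : ℕ → ι}
    (hf : IsAssignment d cell J f) {s : ι} {a b : ℕ} (ha : a ∈ cell s) (hb : b ∈ cell s)
    (hbJ : b ≤ J) {x : ℕ} (hax : a < x) (hxb : x < b) : f x = g x := by
  induction hk : b - a using Nat.strong_induction_on generalizing s a b x with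
  | _ k ih =>
    obtain ⟨t, hat, hbt, z, hz, haz, hzb⟩ := h.exists_between s a ha b hb (by omega)
    have hleft : ∀ y, a < y → y < z → f y = g y := fun y h1 h2 =>
      ih (z - a) (by omega) hat hz (by omega) h1 h2 rfl
    have hright : ∀ y, z < y → y < b → f y = g y := fun y h1 h2 =>
      ih (b - z) (by omega) hz hbt hbJ h1 h2 rfl
    rcases lt_trichotomy x z with hlt | heq | hlt
    · exact hleft x hax hlt
    · subst heq
      have hxJ : x ∈ Finset.Ioo 0 J := Finset.mem_Ioo.2 ⟨by omega, by omega⟩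
      have hxt : x ∈ innerPart (cell t) := mem_innerPart.2 ⟨hz, ⟨a, hat, hax⟩, b, hbt, hxb⟩
      rw [h.eq_inner_of_mem hg hxt]
      by_contra hne
      have hxs := hf.1 x hxJ
      have hnot : x ∉ innerPart (cell (f x)) := fun hm => hne (h.eq_of_mem_innerPart hm hxt)
      have hside : ∀ y ∈ innerPart (cell (f x)), a < y ∧ y < b ∧ y ≠ x := by
        intro y hy
        obtain ⟨hyc, ⟨p, hp, hpy⟩, q, hq, hyq⟩ := mem_innerPart.1 hy
        have hpa : a ≤ p := by
          by_contra hlt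
          exact h.not_cross _ _ hne p hp a hat x hxs b hbt (by omega) hax hxb
        have hqb : q ≤ b := by
          by_contra hlt
          exact h.not_cross _ _ (Ne.symm hne) a hat x hxs b hbt q hq hax hxb (by omega)
        exact ⟨by omega, by omega, fun e => hnot (e ▸ hy)⟩
      refine h.ne_of_inner_subset hf hxJ hnot (fun y hy => ?_) (fun y hy => ?_) rfl
      · have := hside y hy
        exact Finset.mem_Ioo.2 ⟨by omega, by omega⟩
      · obtain ⟨h1, h2, h3⟩ := hside y hy
        rw [← h.eq_inner_of_mem hg hy]
        rcases lt_or_gt_of_ne h3 with h4 | h4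
        · exact hleft y h1 h4
        · exact hright y h4 h2
    · exact hright x hlt hxb

theorem assignments_self_eq_empty (h : IsNoncrossing n d cell)
    (hg : ∀ x, 0 < x → x < n - 1 → x ∈ innerPart (cell (g x))) (hn : 2 ≤ n) :
    assignments d cell g n = ∅ := by
  refine Set.eq_empty_of_forall_notMem fun f hf => ?_
  obtain ⟨t, h0, h1⟩ := h.exists_base
  have hforce : ∀ x, 0 < x → x < n - 1 → f x = g x := fun x hx hxn =>
    h.eq_inner_of_between hg hf.1 h0 h1 (by omega) hx hxn
  refine h.ne_of_inner_subset (t := f (n - 1)) (z := n - 1) hf.1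
    (Finset.mem_Ioo.2 ⟨by omega, by omega⟩) (fun hm => ?_) (fun y hy => ?_) (fun y hy => ?_) rfl
  · exact absurd (h.pos_lt_of_mem_innerPart hm).2 (lt_irrefl _)
  · have := h.pos_lt_of_mem_innerPart hy
    exact Finset.mem_Ioo.2 ⟨by omega, by omega⟩
  · have := h.pos_lt_of_mem_innerPart hy
    rw [hforce y this.1 this.2, h.eq_inner_of_mem hg hy]

theorem assignments_eq_singleton (h : IsNoncrossing n d cell)
    (hg : ∀ x, 0 < x → x < n - 1 → x ∈ innerPart (cell (g x))) {s : ι} {J : ℕ}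
    (h0 : 0 ∈ cell s) (hJ : J ∈ cell s) : assignments d cell g J = {g} := by
  have hJn := h.lt_of_mem s J hJ
  ext f
  rw [Set.mem_singleton_iff]
  constructor
  · intro hf
    funext x
    by_cases hx : x ∈ Finset.Ioo 0 J
    · rw [Finset.mem_Ioo] at hx
      exact h.eq_inner_of_between hg hf.1 h0 hJ le_rfl hx.1 hx.2
    · exact hf.2 x hx
  · rintro rfl
    have hin : ∀ x ∈ Finset.Ioo 0 J, x ∈ innerPart (cell (f x)) := fun x hx => by
      rw [Finset.mem_Ioo] at hx
      exact hg x hx.1 (by omega)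
    refine ⟨⟨fun x hx => (mem_innerPart.1 (hin x hx)).1, fun t S hS hSt => ?_⟩, fun _ _ => rfl⟩
    rw [← h.card_innerPart_cell t]
    exact Finset.card_le_card fun x hx => hSt x hx ▸ hin x (hS hx)

section Recurrence

variable {c : ι} {K V M : ℕ}

theorem assignments_eq_sep (h : IsNoncrossing n d cell)
    (hg : ∀ x, 0 < x → x < n - 1 → x ∈ innerPart (cell (g x)))
    (hK : K ∈ cell c) (hV : V ∈ cell c) (hM : M ∈ cell c) (hK0 : 0 < K) (hKV : K < V)
    (hVM : V < M) (hc : ∀ x ∈ cell c, K ≤ x ∧ x ≤ M) :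
    assignments d cell g M = {f ∈ assignments d cell g V | f K ≠ c} := by
  have hMn := h.lt_of_mem c M hM
  ext f
  constructor
  · intro hf
    have hforce : ∀ x, K < x → x < M → f x = g x := fun x h1 h2 =>
      h.eq_inner_of_between hg hf.1 hK hM le_rfl h1 h2
    have hinner : ∀ y ∈ innerPart (cell c), K < y ∧ y < M := by
      intro y hy
      obtain ⟨-, ⟨p, hp, hpy⟩, q, hq, hyq⟩ := mem_innerPart.1 hy
      have := hc p hp
      have := hc q hq
      omega
    refine ⟨⟨hf.1.mono hVM.le, fun x hx => ?_⟩, ?_⟩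
    · by_cases hxM : x ∈ Finset.Ioo 0 M
      · rw [Finset.mem_Ioo] at hx hxM
        exact hforce x (by omega) (by omega)
      · exact hf.2 x hxM
    · refine h.ne_of_inner_subset hf.1 (Finset.mem_Ioo.2 ⟨hK0, by omega⟩) (fun hm => ?_)
        (fun y hy => ?_) (fun y hy => ?_)
      · exact absurd (hinner K hm).1 (lt_irrefl _)
      · have := hinner y hy
        exact Finset.mem_Ioo.2 ⟨by omega, by omega⟩
      · rw [hforce y (hinner y hy).1 (hinner y hy).2, h.eq_inner_of_mem hg hy]
  · rintro ⟨hf, hfK⟩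
    have hforce : ∀ x, K < x → f x = g x := by
      intro x h1
      by_cases h2 : x < V
      · exact h.eq_inner_of_between hg hf.1 hK hV le_rfl h1 h2
      · exact hf.2 x fun hm => h2 (Finset.mem_Ioo.1 hm).2
    refine ⟨⟨fun x hx => ?_, fun t S hS hSt => ?_⟩, fun x hx => hf.2 x fun hm => hx ?_⟩
    · rw [Finset.mem_Ioo] at hx
      by_cases h2 : x < V
      · exact hf.1.1 x (Finset.mem_Ioo.2 ⟨hx.1, h2⟩)
      · rw [hforce x (by omega)]
        exact (mem_innerPart.1 (hg x hx.1 (by omega))).1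
    · by_cases hSV : S ⊆ Finset.Ioo 0 V
      · exact hf.1.2 t S hSV hSt
      obtain ⟨x, hxS, hxV⟩ := Finset.not_subset.1 hSV
      have hxM := Finset.mem_Ioo.1 (hS hxS)
      rw [Finset.mem_Ioo] at hxV
      have hxt : x ∈ innerPart (cell t) := by
        rw [← hSt x hxS, hforce x (by omega)]
        exact hg x hxM.1 (by omega)
      rw [← h.card_innerPart_cell t]
      refine Finset.card_le_card fun y hy => ?_
      have hyM := Finset.mem_Ioo.1 (hS hy)
      by_cases hyK : K < y
      · rw [← hSt y hy, hforce y hyK]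
        exact hg y hyM.1 (by omega)
      exfalso
      have hyt : y ∈ cell t := by
        rw [← hSt y hy]
        exact hf.1.1 y (Finset.mem_Ioo.2 ⟨hyM.1, by omega⟩)
      have htc : t ≠ c := by
        rintro rfl
        have : y = K := by have := hc y hyt; omega
        exact hfK (this ▸ hSt y hy)
      have hxc := (mem_innerPart.1 hxt).1
      rcases lt_or_eq_of_le (not_lt.1 hyK) with hlt | rfl
      · exact h.not_cross t c htc y hyt K hK x hxc M hM hlt (by omega) hxM.2
      rcases lt_or_eq_of_le (show V ≤ x by omega) with hlt | rfl
      · exact h.not_cross t c htc y hyt V hV x hxc M hM hKV hlt hxM.2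
      · exact htc (h.eq_of_mem_innerPart hxt (mem_innerPart.2 ⟨hV, ⟨y, hK, hKV⟩, M, hM, hVM⟩))
    · rw [Finset.mem_Ioo] at hm ⊢
      omega

theorem image_update_assignments (h : IsNoncrossing n d cell)
    (hg : ∀ x, 0 < x → x < n - 1 → x ∈ innerPart (cell (g x)))
    (hK : K ∈ cell c) (hV : V ∈ cell c) (hM : M ∈ cell c) (hK0 : 0 < K) (hKV : K < V)
    (hVM : V < M) (hc : ∀ x ∈ cell c, K ≤ x ∧ x ≤ M) :
    (fun f => Function.update f K c) '' assignments d cell g K =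
      {f ∈ assignments d cell g V | f K = c} := by
  have hMn := h.lt_of_mem c M hM
  ext f'
  constructor
  · rintro ⟨f, hf, rfl⟩
    have hout : ∀ x, K < x → f x = g x := fun x hx =>
      hf.2 x fun hm => by rw [Finset.mem_Ioo] at hm; omega
    refine ⟨⟨⟨fun x hx => ?_, fun t S hS hSt => ?_⟩, fun x hx => ?_⟩, by simp⟩
    · rw [Finset.mem_Ioo] at hx
      rcases lt_trichotomy x K with hlt | rfl | hlt
      · simpa [Function.update_of_ne hlt.ne] using hf.1.1 x (Finset.mem_Ioo.2 ⟨hx.1, hlt⟩)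
      · simpa using hK
      · simp only [Function.update_of_ne hlt.ne']
        rw [hout x hlt]
        exact (mem_innerPart.1 (hg x hx.1 (by omega))).1
    · have hval : ∀ x ∈ S, x ≠ K → f x = t := fun x hx hne => by
        simpa [Function.update_of_ne hne] using hSt x hx
      by_cases htc : t = c
      · subst htc
        have hVin : V ∈ innerPart (cell t) := mem_innerPart.2 ⟨hV, ⟨K, hK, hKV⟩, M, hM, hVM⟩
        have hsub : S ⊆ insert K ((innerPart (cell t)).erase V) := by
          intro x hx
          have hxV := Finset.mem_Ioo.1 (hS hx)
          by_cases hne : x = K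
          · exact hne ▸ Finset.mem_insert_self _ _
          refine Finset.mem_insert_of_mem (Finset.mem_erase.2 ⟨by omega, ?_⟩)
          have hfx := hval x hx hne
          by_cases hlt : x < K
          · have := hf.1.1 x (Finset.mem_Ioo.2 ⟨hxV.1, hlt⟩)
            have := hc x (hfx ▸ this)
            omega
          · rw [← hfx, hout x (by omega)]
            exact hg x hxV.1 (by omega)
        have h1 := (Finset.card_le_card hsub).trans (Finset.card_insert_le _ _)
        rw [Finset.card_erase_of_mem hVin, h.card_innerPart_cell] at h1
        have := h.three_le
        omega
      · have hSK : K ∉ S := fun hm => htc (by simpa using (hSt K hm).symm)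
        have hneK : ∀ x ∈ S, x ≠ K := fun x hx e => hSK (e ▸ hx)
        by_cases hSub : S ⊆ Finset.Ioo 0 K
        · exact hf.1.2 t S hSub fun x hx => hval x hx (hneK x hx)
        obtain ⟨x, hxS, hxK⟩ := Finset.not_subset.1 hSub
        have hxV := Finset.mem_Ioo.1 (hS hxS)
        rw [Finset.mem_Ioo] at hxK
        have hinner : ∀ y ∈ S, K < y → y ∈ innerPart (cell t) := by
          intro y hy hlt
          have hyV := Finset.mem_Ioo.1 (hS hy)
          rw [← hval y hy hlt.ne', hout y hlt]
          exact hg y hyV.1 (by omega)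
        have hKx : K < x := by have := hneK x hxS; omega
        rw [← h.card_innerPart_cell t]
        refine Finset.card_le_card fun y hy => ?_
        by_cases hlt : K < y
        · exact hinner y hy hlt
        exfalso
        have hyK : y < K := by have := hneK y hy; omega
        have hyt : y ∈ cell t := by
          rw [← hval y hy hyK.ne]
          exact hf.1.1 y (Finset.mem_Ioo.2 ⟨(Finset.mem_Ioo.1 (hS hy)).1, hyK⟩)
        exact h.not_cross t c htc y hyt K hK x (mem_innerPart.1 (hinner x hxS hKx)).1 M hM
          hyK hKx (by omega)
    · have hne : x ≠ K := by rintro rfl; exact hx (Finset.mem_Ioo.2 ⟨hK0, hKV⟩)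
      simp only [Function.update_of_ne hne]
      exact hf.2 x fun hm => hx (Finset.Ioo_subset_Ioo_right hKV.le hm)
  · rintro ⟨hf, hfK⟩
    refine ⟨Function.update f' K (g K), ⟨⟨fun x hx => ?_, fun t S hS hSt => ?_⟩,
      fun x hx => ?_⟩, ?_⟩
    · have hne : x ≠ K := (Finset.mem_Ioo.1 hx).2.ne
      rw [Function.update_of_ne hne]
      exact hf.1.1 x (Finset.Ioo_subset_Ioo_right hKV.le hx)
    · refine hf.1.2 t S (hS.trans (Finset.Ioo_subset_Ioo_right hKV.le)) fun x hx => ?_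
      have hne : x ≠ K := (Finset.mem_Ioo.1 (hS hx)).2.ne
      rw [← hSt x hx, Function.update_of_ne hne]
    · by_cases hne : x = K
      · subst hne
        simp
      rw [Function.update_of_ne hne]
      by_cases hxV : x ∈ Finset.Ioo 0 V
      · rw [Finset.mem_Ioo] at hx hxV
        exact h.eq_inner_of_between hg hf.1 hK hV le_rfl (by omega) hxV.2
      · exact hf.2 x hxV
    · simp [← hfK]

theorem ncard_assignments_add (h : IsNoncrossing n d cell)
    (hg : ∀ x, 0 < x → x < n - 1 → x ∈ innerPart (cell (g x)))
    (hK : K ∈ cell c) (hV : V ∈ cell c) (hM : M ∈ cell c) (hK0 : 0 < K) (hKV : K < V)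
    (hVM : V < M) (hc : ∀ x ∈ cell c, K ≤ x ∧ x ≤ M)
    (hfin : (assignments d cell g V).Finite) :
    (assignments d cell g V).ncard =
      (assignments d cell g K).ncard + (assignments d cell g M).ncard := by
  have hinj : Set.InjOn (fun f => Function.update f K c) (assignments d cell g K) := by
    intro f₁ h₁ f₂ h₂ heq
    funext x
    by_cases hx : x = K
    · have hnot : x ∉ Finset.Ioo 0 K := by simp [hx]
      rw [h₁.2 x hnot, h₂.2 x hnot]
    · simpa [Function.update_of_ne hx] using congrFun heq x
  have hdisj : Disjoint {f ∈ assignments d cell g V | f K = c}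
      {f ∈ assignments d cell g V | f K ≠ c} :=
    Set.disjoint_left.2 fun f h₁ h₂ => h₂.2 h₁.2
  rw [← hinj.ncard_image, h.image_update_assignments hg hK hV hM hK0 hKV hVM hc,
    h.assignments_eq_sep hg hK hV hM hK0 hKV hVM hc, ← Set.ncard_union_eq hdisj
      (hfin.subset (Set.sep_subset _ _)) (hfin.subset (Set.sep_subset _ _))]
  congr 1
  ext f
  simp only [Set.mem_union, Set.mem_sep_iff]
  tauto

end Recurrence

end IsNoncrossing

/-- Twice the signed area of the triangle `p q r`. -/
def orient (p q r : ℝ × ℝ) : ℝ := (q.1 - p.1) * (r.2 - p.2) - (q.2 - p.2) * (r.1 - p.1)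

theorem orient_circle_pos {α β γ : ℝ} (h₁ : α < β) (h₂ : β < γ) (h₃ : γ < α + 2 * Real.pi) :
    0 < orient (Real.cos α, Real.sin α) (Real.cos β, Real.sin β) (Real.cos γ, Real.sin γ) := by
  obtain ⟨u, rfl⟩ : ∃ u, β = α + 2 * u := ⟨(β - α) / 2, by ring⟩
  obtain ⟨w, rfl⟩ : ∃ w, γ = α + 2 * u + 2 * w := ⟨(γ - (α + 2 * u)) / 2, by ring⟩
  have key : orient (Real.cos α, Real.sin α) (Real.cos (α + 2 * u), Real.sin (α + 2 * u))
      (Real.cos (α + 2 * u + 2 * w), Real.sin (α + 2 * u + 2 * w)) =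
      4 * Real.sin u * Real.sin w * Real.sin (u + w) := by
    have e1 := Real.sin_sq_add_cos_sq α
    have e2 := Real.sin_sq_add_cos_sq u
    have e3 := Real.sin_sq_add_cos_sq w
    simp only [orient, Real.cos_add, Real.sin_add, Real.sin_two_mul, Real.cos_two_mul']
    have hc : Real.cos α ^ 2 = 1 - Real.sin α ^ 2 := by linarith
    have hcu : Real.cos u ^ 2 = 1 - Real.sin u ^ 2 := by linarith
    have hcw : Real.cos w ^ 2 = 1 - Real.sin w ^ 2 := by linarith
    grind
  rw [key]
  have hu := Real.sin_pos_of_pos_of_lt_pi (x := u) (by linarith) (by linarith)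
  have hw := Real.sin_pos_of_pos_of_lt_pi (x := w) (by linarith) (by linarith)
  have huw := Real.sin_pos_of_pos_of_lt_pi (x := u + w) (by linarith) (by linarith)
  positivity

theorem vtx_add_natCast (n : ℕ) [NeZero n] (i : ZMod n) (u : ℕ) :
    vtx n (i + u) = (Real.cos (2 * Real.pi * (i.val + u : ℕ) / n),
      Real.sin (2 * Real.pi * (i.val + u : ℕ) / n)) := by
  have hn : (n : ℝ) ≠ 0 := Nat.cast_ne_zero.2 (NeZero.ne n)
  have hval : (i + u).val = (i.val + u) % n := by
    rw [ZMod.val_add, ZMod.val_natCast, Nat.add_mod_mod]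
  have hdecomp : 2 * Real.pi * (i.val + u : ℕ) / n =
      2 * Real.pi * ((i.val + u) % n : ℕ) / n + ((i.val + u) / n : ℕ) * (2 * Real.pi) := by
    have h : (((i.val + u) % n : ℕ) : ℝ) + n * ((i.val + u) / n : ℕ) = (i.val + u : ℕ) := by
      exact_mod_cast Nat.mod_add_div _ _
    rw [← h]
    field_simp
  rw [vtx, hval, hdecomp, Real.cos_add_nat_mul_two_pi, Real.sin_add_nat_mul_two_pi]

/-- The points `Q 0, …, Q (n - 1)` are in convex position, in counterclockwise order. -/
def IsConvexChain (n : ℕ) (Q : ℕ → ℝ × ℝ) : Prop :=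
  ∀ x y z, x < y → y < z → z < n → 0 < orient (Q x) (Q y) (Q z)

theorem isConvexChain_vtx (n : ℕ) [NeZero n] (i : ZMod n) :
    IsConvexChain n (fun u => vtx n (i + u)) := by
  intro x y z hxy hyz hzn
  have hn : (0 : ℝ) < n := Nat.cast_pos.2 (NeZero.pos n)
  have hpi := Real.pi_pos
  have hmono : ∀ a b : ℕ, a < b →
      2 * Real.pi * (a : ℝ) / n < 2 * Real.pi * (b : ℝ) / n := fun a b hab => by
    have : (a : ℝ) < b := Nat.cast_lt.2 hab
    gcongr
  simp only [vtx_add_natCast]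
  refine orient_circle_pos (hmono _ _ (by omega)) (hmono _ _ (by omega)) ?_
  have h := hmono (i.val + z) (i.val + x + n) (by omega)
  refine h.trans_eq ?_
  push_cast
  field_simp

theorem orient_swap (p q r : ℝ × ℝ) : orient p q r = -orient q p r := by
  simp only [orient]; ring

theorem orient_swap' (p q r : ℝ × ℝ) : orient p q r = -orient p r q := by
  simp only [orient]; ring

theorem orient_combo (p r x y : ℝ × ℝ) {a b : ℝ} (hab : a + b = 1) :
    orient p (a • x + b • y) r = a * orient p x r + b * orient p y r := by
  obtain rfl : b = 1 - a := by linarith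
  simp only [orient, Prod.fst_add, Prod.snd_add, Prod.smul_fst, Prod.smul_snd, smul_eq_mul]
  ring

theorem continuous_orient_left (q r : ℝ × ℝ) : Continuous fun p => orient p q r := by
  unfold orient; fun_prop

/-- A counterclockwise triangle has interior points. -/
theorem interior_nonempty_of_orient_pos {S : Set (ℝ × ℝ)} {A B C : ℝ × ℝ} (hA : A ∈ S)
    (hB : B ∈ S) (hC : C ∈ S) (h : 0 < orient A B C) : (interior (convexHull ℝ S)).Nonempty := by
  let U : Set (ℝ × ℝ) := {p | 0 < orient p B C} ∩ {p | 0 < orient p C A} ∩ {p | 0 < orient p A B}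
  have hU : IsOpen U :=
    ((isOpen_lt continuous_const (continuous_orient_left B C)).inter
      (isOpen_lt continuous_const (continuous_orient_left C A))).inter
      (isOpen_lt continuous_const (continuous_orient_left A B))
  have hsub : U ⊆ convexHull ℝ S := by
    rintro p ⟨⟨h1, h2⟩, h3⟩
    simp only [Set.mem_ofPred_eq] at h1 h2 h3
    have hsum : orient p B C + orient p C A + orient p A B = orient A B C := by
      simp only [orient]; ring
    have hp : p = (orient p B C / orient A B C) • A + (orient p C A / orient A B C) • B +
        (orient p A B / orient A B C) • C := by
      ext
      · simp only [Prod.fst_add, Prod.smul_fst, smul_eq_mul]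
        field_simp
        simp only [orient]; ring
      · simp only [Prod.snd_add, Prod.smul_snd, smul_eq_mul]
        field_simp
        simp only [orient]; ring
    have hmem := (convex_convexHull ℝ S).sum_mem (t := Finset.univ)
      (w := ![orient p B C / orient A B C, orient p C A / orient A B C,
        orient p A B / orient A B C]) (z := ![A, B, C])
      (by simp [Fin.forall_fin_succ, (div_pos h1 h).le, (div_pos h2 h).le, (div_pos h3 h).le])
      (by simp [Fin.sum_univ_three, ← add_div, hsum, h.ne'])
      (by simp [Fin.forall_fin_succ, subset_convexHull ℝ S hA, subset_convexHull ℝ S hB,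
        subset_convexHull ℝ S hC])
    rw [hp]
    simpa [Fin.sum_univ_three] using hmem
  refine ⟨(1 / 3 : ℝ) • A + (1 / 3 : ℝ) • B + (1 / 3 : ℝ) • C,
    interior_maximal hsub hU ⟨⟨?_, ?_⟩, ?_⟩⟩ <;>
  · simp only [Set.mem_ofPred_eq]
    refine (div_pos h (show (0 : ℝ) < 3 by norm_num)).trans_eq ?_
    simp only [orient, Prod.fst_add, Prod.snd_add, Prod.smul_fst, Prod.smul_snd, smul_eq_mul]
    ring

/-- A linear functional on the plane with equal values at the vertices of a nondegenerate
triangle vanishes. -/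
theorem eq_zero_of_orient_pos {f : ℝ × ℝ →L[ℝ] ℝ} {A B C : ℝ × ℝ} (h : 0 < orient A B C)
    (hAB : f A = f B) (hAC : f A = f C) (p : ℝ × ℝ) : f p = 0 := by
  have hf : ∀ q : ℝ × ℝ, f q = q.1 * f (1, 0) + q.2 * f (0, 1) := fun q => by
    have hq : q = q.1 • ((1, 0) : ℝ × ℝ) + q.2 • ((0, 1) : ℝ × ℝ) := by ext <;> simp
    conv_lhs => rw [hq, map_add, map_smul, map_smul]
    simp
  rw [hf A, hf B] at hAB
  rw [hf A, hf C] at hAC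
  have h1 : orient A B C * f (1, 0) = 0 := by
    simp only [orient]
    linear_combination (C.2 - A.2) * (-hAB) + (B.2 - A.2) * hAC
  have h2 : orient A B C * f (0, 1) = 0 := by
    simp only [orient]
    linear_combination (C.1 - A.1) * hAB - (B.1 - A.1) * hAC
  rw [hf, (mul_eq_zero.1 h1).resolve_left h.ne', (mul_eq_zero.1 h2).resolve_left h.ne']
  simp

theorem convexHull_subset_pos_or_eq {S : Set (ℝ × ℝ)} {p q r : ℝ × ℝ}
    (hq : orient p q r = 0) (hS : ∀ s ∈ S, 0 < orient p s r ∨ s = q) :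
    ∀ s ∈ convexHull ℝ S, 0 < orient p s r ∨ s = q := by
  have hconv : Convex ℝ {s | 0 < orient p s r ∨ s = q} := by
    rw [convex_iff_forall_pos]
    rintro x hx y hy a b ha hb hab
    simp only [Set.mem_ofPred_eq] at hx hy ⊢
    rw [orient_combo p r x y hab]
    rcases hx with hx | rfl <;> rcases hy with hy | rfl
    · left; positivity
    · left; rw [hq]; simpa using mul_pos ha hx
    · left; rw [hq]; simpa using mul_pos hb hy
    · right; rw [← add_smul, hab, one_smul]
  exact fun s hs => convexHull_min hS hconv hs

section Chain

variable {n : ℕ} {Q : ℕ → ℝ × ℝ}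

theorem IsConvexChain.interior_nonempty (hQ : IsConvexChain n Q) {c : Finset ℕ}
    (hc : 3 ≤ c.card) (hlt : ∀ x ∈ c, x < n) :
    (interior (convexHull ℝ (Q '' (c : Set ℕ)))).Nonempty := by
  have hpos : 0 < (innerPart c).card := by rw [card_innerPart (by omega)]; omega
  obtain ⟨x, hx⟩ := Finset.card_pos.1 hpos
  obtain ⟨hxc, ⟨a, ha, hax⟩, b, hb, hxb⟩ := mem_innerPart.1 hx
  exact interior_nonempty_of_orient_pos (Set.mem_image_of_mem Q ha)
    (Set.mem_image_of_mem Q hxc) (Set.mem_image_of_mem Q hb) (hQ a x b hax hxb (hlt b hb))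

/-- Polygons with crossing diagonals have overlapping interiors. -/
theorem IsConvexChain.not_cross (hQ : IsConvexChain n Q) {s t : Finset ℕ}
    (hs : 3 ≤ s.card) (ht : 3 ≤ t.card) (hsn : ∀ x ∈ s, x < n) (htn : ∀ x ∈ t, x < n)
    (hdisj : interior (convexHull ℝ (Q '' (s : Set ℕ))) ∩
      interior (convexHull ℝ (Q '' (t : Set ℕ))) = ∅) {a x b y : ℕ}
    (ha : a ∈ s) (hx : x ∈ t) (hb : b ∈ s) (hy : y ∈ t) (hax : a < x) (hxb : x < b)
    (hby : b < y) : False := by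
  have hcs := convex_convexHull ℝ (Q '' (s : Set ℕ))
  have hct := convex_convexHull ℝ (Q '' (t : Set ℕ))
  obtain ⟨p, hp⟩ := hQ.interior_nonempty hs hsn
  obtain ⟨q, hq⟩ := hQ.interior_nonempty ht htn
  obtain ⟨f, u, hfs, hft⟩ := geometric_hahn_banach_open_open hcs.interior isOpen_interior
    hct.interior isOpen_interior (Set.disjoint_iff_inter_eq_empty.2 hdisj)
  have hles : ∀ v ∈ s, f (Q v) ≤ u := by
    intro v hv
    have hcl : Q v ∈ closure (interior (convexHull ℝ (Q '' (s : Set ℕ)))) := by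
      rw [hcs.closure_interior_eq_closure_of_nonempty_interior ⟨p, hp⟩]
      exact subset_closure (subset_convexHull ℝ _ (Set.mem_image_of_mem Q hv))
    exact closure_minimal (fun w hw => (hfs w hw).le)
      (isClosed_le f.continuous continuous_const) hcl
  have hlet : ∀ v ∈ t, u ≤ f (Q v) := by
    intro v hv
    have hcl : Q v ∈ closure (interior (convexHull ℝ (Q '' (t : Set ℕ)))) := by
      rw [hct.closure_interior_eq_closure_of_nonempty_interior ⟨q, hq⟩]
      exact subset_closure (subset_convexHull ℝ _ (Set.mem_image_of_mem Q hv))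
    exact closure_minimal (fun w hw => (hft w hw).le)
      (isClosed_le continuous_const f.continuous) hcl
  have hyn := htn y hy
  have pa := hQ x b y hxb hby hyn
  have pb := hQ a x y hax (by omega) hyn
  have px := hQ a b y (by omega) hby hyn
  have py := hQ a x b hax hxb (by omega)
  have hrel : orient (Q x) (Q b) (Q y) • Q a + orient (Q a) (Q x) (Q y) • Q b =
      orient (Q a) (Q b) (Q y) • Q x + orient (Q a) (Q x) (Q b) • Q y := by
    ext <;> simp [orient] <;> ring
  have hsum : orient (Q x) (Q b) (Q y) + orient (Q a) (Q x) (Q y) =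
      orient (Q a) (Q b) (Q y) + orient (Q a) (Q x) (Q b) := by
    simp only [orient]; ring
  have hfrel := congrArg f hrel
  simp only [map_add, map_smul, smul_eq_mul] at hfrel
  have ea := mul_nonneg pa.le (sub_nonneg.2 (hles a ha))
  have eb := mul_nonneg pb.le (sub_nonneg.2 (hles b hb))
  have ex := mul_nonneg px.le (sub_nonneg.2 (hlet x hx))
  have ey := mul_nonneg py.le (sub_nonneg.2 (hlet y hy))
  have htot : orient (Q x) (Q b) (Q y) * (u - f (Q a)) + orient (Q a) (Q x) (Q y) * (u - f (Q b)) +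
      orient (Q a) (Q b) (Q y) * (f (Q x) - u) + orient (Q a) (Q x) (Q b) * (f (Q y) - u) = 0 := by
    linear_combination u * hsum - hfrel
  have va : u - f (Q a) = 0 := (mul_eq_zero.1 (by linarith)).resolve_left pa.ne'
  have vb : u - f (Q b) = 0 := (mul_eq_zero.1 (by linarith)).resolve_left pb.ne'
  have vx : f (Q x) - u = 0 := (mul_eq_zero.1 (by linarith)).resolve_left px.ne'
  have hzero := eq_zero_of_orient_pos (f := f) py (by linarith) (by linarith)
  have h1 := hfs p hp
  have h2 := hft q hq
  rw [hzero] at h1 h2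
  linarith

theorem IsConvexChain.ne (hQ : IsConvexChain n Q) (hn : 3 ≤ n) {a b : ℕ} (hab : a < b)
    (hb : b < n) : Q a ≠ Q b := by
  intro heq
  have hzero : ∀ z, orient (Q a) (Q b) z = 0 := fun z => by rw [heq]; simp [orient]
  by_cases h1 : b + 1 < n
  · exact (hQ a b (b + 1) hab (by omega) h1).ne' (hzero _)
  by_cases h2 : a + 1 < b
  · have := hQ a (a + 1) b (by omega) h2 hb
    rw [orient_swap', hzero] at this
    simp at this
  · have := hQ 0 a b (by omega) hab hb
    rw [heq] at this
    simp [orient] at this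
    linarith

/-- If the midpoint of the chord `a b` lies in a polygon with vertices in `[a, b]`, then `a` and `b`
are vertices of this polygon. -/
theorem IsConvexChain.mem_of_midpoint_mem (hQ : IsConvexChain n Q) (hn : 3 ≤ n) {t : Finset ℕ}
    {a b : ℕ} (hab : a < b) (hb : b < n) (ht : ∀ x ∈ t, a ≤ x ∧ x ≤ b)
    (hmid : (1 / 2 : ℝ) • Q a + (1 / 2 : ℝ) • Q b ∈ convexHull ℝ (Q '' (t : Set ℕ))) :
    a ∈ t ∧ b ∈ t := by
  have hne := hQ.ne hn hab hb
  have h0 : orient (Q a) ((1 / 2 : ℝ) • Q a + (1 / 2 : ℝ) • Q b) (Q b) = 0 := by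
    rw [orient_combo _ _ _ _ (by norm_num)]
    simp only [orient]; ring
  constructor <;> by_contra hnot
  · have hor := convexHull_subset_pos_or_eq (p := Q a) (q := Q b) (r := Q b)
      (by simp only [orient]; ring) (by
        rintro _ ⟨x, hx, rfl⟩
        have hxab := ht x hx
        have hxa : x ≠ a := fun e => hnot (e ▸ hx)
        by_cases hxb : x = b
        · exact Or.inr (by rw [hxb])
        · exact Or.inl (hQ a x b (by omega) (by omega) hb)) _ hmid
    rw [h0] at hor
    have heq := hor.resolve_left (lt_irrefl _)
    have h1 := congrArg Prod.fst heq
    have h2 := congrArg Prod.snd heq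
    simp only [Prod.fst_add, Prod.snd_add, Prod.smul_fst, Prod.smul_snd, smul_eq_mul] at h1 h2
    exact hne (Prod.ext (by linarith) (by linarith))
  · have hor := convexHull_subset_pos_or_eq (p := Q a) (q := Q a) (r := Q b)
      (by simp only [orient]; ring) (by
        rintro _ ⟨x, hx, rfl⟩
        have hxab := ht x hx
        have hxa : x ≠ b := fun e => hnot (e ▸ hx)
        by_cases hxb : x = a
        · exact Or.inr (by rw [hxb])
        · exact Or.inl (hQ a x b (by omega) (by omega) hb)) _ hmid
    rw [h0] at hor
    have heq := hor.resolve_left (lt_irrefl _)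
    have h1 := congrArg Prod.fst heq
    have h2 := congrArg Prod.snd heq
    simp only [Prod.fst_add, Prod.snd_add, Prod.smul_fst, Prod.smul_snd, smul_eq_mul] at h1 h2
    exact hne (Prod.ext (by linarith) (by linarith))

/-- In a finite cover of the polygon, some member contains the midpoint of the chord `a b` and has
a vertex strictly between `a` and `b`. -/
theorem IsConvexChain.exists_midpoint_mem {ι : Type*} [Finite ι] {cell : ι → Finset ℕ}
    (hQ : IsConvexChain n Q) (hlt : ∀ t, ∀ x ∈ cell t, x < n)
    (hcover : ∀ p ∈ convexHull ℝ (Q '' {x | x < n}),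
      ∃ t, p ∈ convexHull ℝ (Q '' (cell t : Set ℕ))) {a b : ℕ} (hab : a + 1 < b) (hb : b < n) :
    ∃ t, (1 / 2 : ℝ) • Q a + (1 / 2 : ℝ) • Q b ∈ convexHull ℝ (Q '' (cell t : Set ℕ)) ∧
      ∃ z ∈ cell t, a < z ∧ z < b := by
  set mid := (1 / 2 : ℝ) • Q a + (1 / 2 : ℝ) • Q b with hmid
  have h0 : orient (Q a) mid (Q b) = 0 := by
    rw [hmid, orient_combo _ _ _ _ (by norm_num)]
    simp only [orient]; ring
  have hpos := hQ a (a + 1) b (by omega) hab hb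
  let ε : ℕ → ℝ := fun k => 1 / ((k : ℝ) + 1)
  let p : ℕ → ℝ × ℝ := fun k => (1 - ε k) • mid + ε k • Q (a + 1)
  have hε : ∀ k, 0 < ε k := fun k => Nat.one_div_pos_of_nat
  have hε1 : ∀ k, ε k ≤ 1 := fun k => by
    have : (0 : ℝ) ≤ k := Nat.cast_nonneg k
    exact div_le_one_of_le₀ (by linarith) (by linarith)
  have htend : Filter.Tendsto p Filter.atTop (nhds mid) := by
    have hεt : Filter.Tendsto ε Filter.atTop (nhds 0) := tendsto_one_div_add_atTop_nhds_zero_nat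
    have := ((tendsto_const_nhds (x := (1 : ℝ))).sub hεt).smul_const mid |>.add
      (hεt.smul_const (Q (a + 1)))
    simpa using this
  have hvert : ∀ x, x < n → Q x ∈ convexHull ℝ (Q '' {x | x < n}) := fun x hx =>
    subset_convexHull ℝ _ (Set.mem_image_of_mem Q hx)
  have hconv := convex_convexHull ℝ (Q '' {x | x < n})
  have hmem : ∀ k, ∃ t, p k ∈ convexHull ℝ (Q '' (cell t : Set ℕ)) := fun k =>
    hcover _ (hconv (hconv (hvert a (by omega)) (hvert b hb) (by norm_num) (by norm_num)
      (by norm_num)) (hvert (a + 1) (by omega)) (by linarith [hε1 k]) (hε k).le (by ring))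
  have hfreq : ∃ t, ∃ᶠ k in Filter.atTop, p k ∈ convexHull ℝ (Q '' (cell t : Set ℕ)) := by
    by_contra hcon
    push Not at hcon
    obtain ⟨k, hk⟩ := (Filter.eventually_all.2 hcon).exists
    obtain ⟨t, ht⟩ := hmem k
    exact hk t ht
  obtain ⟨t, ht⟩ := hfreq
  refine ⟨t, (((cell t).finite_toSet.image Q).isClosed_convexHull ℝ).mem_of_frequently_of_tendsto
    ht htend, ?_⟩
  by_contra hcon
  push Not at hcon
  obtain ⟨k, hk⟩ := ht.exists
  have hle : convexHull ℝ (Q '' (cell t : Set ℕ)) ⊆ {q | orient (Q a) q (Q b) ≤ 0} := by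
    refine convexHull_min ?_ fun x hx y hy c e hc he hce => ?_
    · rintro _ ⟨x, hx, rfl⟩
      have hxn := hlt t x hx
      simp only [Set.mem_ofPred_eq]
      rcases lt_trichotomy x a with h1 | rfl | h1
      · rw [orient_swap]
        linarith [hQ x a b h1 (by omega) hb]
      · simp [orient]
      · rcases lt_or_eq_of_le (hcon x hx h1) with h2 | rfl
        · rw [orient_swap']
          linarith [hQ a b x (by omega) h2 hxn]
        · exact (show orient (Q a) (Q b) (Q b) = 0 by simp only [orient]; ring).le
    · simp only [Set.mem_ofPred_eq] at hx hy ⊢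
      rw [orient_combo _ _ _ _ hce]
      nlinarith
  have hkle : orient (Q a) (p k) (Q b) ≤ 0 := hle hk
  rw [orient_combo _ _ _ _ (by ring), h0] at hkle
  nlinarith [mul_pos (hε k) hpos]

end Chain

theorem zmod_val_sub_eq_ite {n : ℕ} [NeZero n] (a b : ZMod n) :
    (a - b).val = if b.val ≤ a.val then a.val - b.val else n + a.val - b.val := by
  split_ifs with h
  · exact ZMod.val_sub h
  · have hne : b - a ≠ 0 := fun e => h (by rw [sub_eq_zero.1 e])
    have : NeZero (b - a) := ⟨hne⟩
    have := a.val_lt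
    have := b.val_lt
    rw [← neg_sub, ZMod.val_neg_of_ne_zero, ZMod.val_sub (by omega)]
    omega

theorem pathLen_self {n : ℕ} (hn : 2 ≤ n) (i : ZMod n) : pathLen n i i + 1 = n := by
  have : NeZero n := ⟨by omega⟩
  have : Fact (1 < n) := ⟨by omega⟩
  rw [pathLen, zmod_val_sub_eq_ite, sub_self, ZMod.val_zero, ZMod.val_one]
  simp only [nonpos_iff_eq_zero, one_ne_zero, if_false]
  omega

theorem pathLen_of_ne {n : ℕ} (hn : 2 ≤ n) {i j : ZMod n} (h : j ≠ i) :
    pathLen n i j + 1 = (j - i).val := by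
  have : NeZero n := ⟨by omega⟩
  have : Fact (1 < n) := ⟨by omega⟩
  have hpos : 0 < (j - i).val := by
    rw [Nat.pos_iff_ne_zero, Ne, ZMod.val_eq_zero, sub_eq_zero]
    exact h
  rw [pathLen, zmod_val_sub_eq_ite, ZMod.val_one, if_pos (by omega)]
  omega

/-- The vertex set of a cell in counterclockwise coordinates based at the vertex `i`. -/
def coordCell (n : ℕ) (T : Finset (Finset (ZMod n))) (i : ZMod n) (t : {c // c ∈ T}) : Finset ℕ :=
  (t : Finset (ZMod n)).image fun v => (v - i).val

section Coordinates

variable {n d : ℕ} {T : Finset (Finset (ZMod n))} {i : ZMod n}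

theorem add_val_sub [NeZero n] (i v : ZMod n) : i + (((v - i).val : ℕ) : ZMod n) = v := by
  rw [ZMod.natCast_zmod_val, add_sub_cancel]

theorem val_sub_mem_coordCell (t : {c // c ∈ T}) {v : ZMod n} (hv : v ∈ (t : Finset (ZMod n))) :
    (v - i).val ∈ coordCell n T i t := Finset.mem_image_of_mem _ hv

theorem mem_coordCell [NeZero n] (t : {c // c ∈ T}) {u : ℕ} (hu : u < n) :
    u ∈ coordCell n T i t ↔ i + (u : ZMod n) ∈ (t : Finset (ZMod n)) := by
  constructor
  · intro h
    obtain ⟨v, hv, rfl⟩ := Finset.mem_image.1 h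
    rwa [add_val_sub]
  · intro h
    have := val_sub_mem_coordCell (i := i) t h
    rwa [add_sub_cancel_left, ZMod.val_cast_of_lt hu] at this

theorem image_coordCell [NeZero n] (t : {c // c ∈ T}) :
    (fun u : ℕ => vtx n (i + u)) '' (coordCell n T i t : Set ℕ) =
      vtx n '' ((t : Finset (ZMod n)) : Set (ZMod n)) := by
  simp only [coordCell, Finset.coe_image, Set.image_image, add_val_sub]

theorem image_lt_eq_range_vtx [NeZero n] (i : ZMod n) :
    (fun u : ℕ => vtx n (i + u)) '' {x | x < n} = Set.range (vtx n) := by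
  ext p
  constructor
  · rintro ⟨u, -, rfl⟩
    exact ⟨_, rfl⟩
  · rintro ⟨v, rfl⟩
    exact ⟨(v - i).val, ZMod.val_lt _, by simp only [add_val_sub]⟩

theorem coordCell_lt [NeZero n] (t : {c // c ∈ T}) : ∀ x ∈ coordCell n T i t, x < n := by
  intro x hx
  obtain ⟨v, -, rfl⟩ := Finset.mem_image.1 hx
  exact ZMod.val_lt _

theorem injective_val_sub [NeZero n] (i : ZMod n) :
    Function.Injective fun v : ZMod n => (v - i).val := fun v w h => by
  rw [← add_val_sub i v, ← add_val_sub i w]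
  exact congrArg (fun u : ℕ => i + (u : ZMod n)) h

theorem IsDAngulation.isNoncrossing [NeZero n] (hd : 3 ≤ d) (hn : 3 ≤ n)
    (hT : IsDAngulation n d T) (i : ZMod n) : IsNoncrossing n d (coordCell n T i) := by
  obtain ⟨hcard, hcover, hdisj⟩ := hT
  have hQ := isConvexChain_vtx n i
  have hcardc : ∀ t, (coordCell n T i t).card = d := fun t => by
    rw [coordCell, Finset.card_image_of_injective _ (injective_val_sub i), hcard t t.2]
  have hcross : ∀ s t, s ≠ t → ∀ a ∈ coordCell n T i s, ∀ x ∈ coordCell n T i t,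
      ∀ b ∈ coordCell n T i s, ∀ y ∈ coordCell n T i t, a < x → x < b → b < y → False := by
    intro s t hst a ha x hx b hb y hy
    refine hQ.not_cross (by rw [hcardc]; exact hd) (by rw [hcardc]; exact hd) (coordCell_lt s)
      (coordCell_lt t) ?_ ha hx hb hy
    rw [image_coordCell, image_coordCell]
    exact hdisj s s.2 t t.2 fun e => hst (Subtype.ext e)
  have hcov : ∀ p ∈ convexHull ℝ ((fun u : ℕ => vtx n (i + u)) '' {x | x < n}),
      ∃ t : {c // c ∈ T},
        p ∈ convexHull ℝ ((fun u : ℕ => vtx n (i + u)) '' (coordCell n T i t : Set ℕ)) := by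
    intro p hp
    rw [image_lt_eq_range_vtx, ← hcover] at hp
    simp only [Set.mem_iUnion] at hp
    obtain ⟨c, hc, hpc⟩ := hp
    exact ⟨⟨c, hc⟩, by rwa [image_coordCell]⟩
  refine ⟨hd, hcardc, fun s t h => Subtype.ext (Finset.image_injective (injective_val_sub i) h),
    coordCell_lt, hcross, fun s a ha b hb hab => ?_, ?_⟩
  · by_cases hz : ∃ z ∈ coordCell n T i s, a < z ∧ z < b
    · exact ⟨s, ha, hb, hz⟩
    have hbn := coordCell_lt s b hb
    obtain ⟨t, hmid, z, hzt, haz, hzb⟩ := hQ.exists_midpoint_mem coordCell_lt hcov hab hbn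
    have hst : s ≠ t := fun e => hz ⟨z, e ▸ hzt, haz, hzb⟩
    have hsub : ∀ x ∈ coordCell n T i t, a ≤ x ∧ x ≤ b := fun x hx =>
      ⟨not_lt.1 fun h => hcross t s hst.symm x hx a ha z hzt b hb h haz hzb,
        not_lt.1 fun h => hcross s t hst a ha z hzt b hb x hx haz hzb h⟩
    obtain ⟨hat, hbt⟩ := hQ.mem_of_midpoint_mem hn (by omega) hbn hsub hmid
    exact ⟨t, hat, hbt, z, hzt, haz, hzb⟩
  · obtain ⟨t, hmid, -⟩ := hQ.exists_midpoint_mem coordCell_lt hcov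
      (show 0 + 1 < n - 1 by omega) (by omega)
    refine ⟨t, hQ.mem_of_midpoint_mem hn (by omega) (by omega) (fun x hx => ?_) hmid⟩
    have := coordCell_lt t x hx
    omega

theorem isDPath_iff_isAssignment [NeZero n] (f : ℕ → {c // c ∈ T}) (j : ZMod n) :
    IsDPath n d T i j (fun k => f (k + 1)) ↔
      IsAssignment d (coordCell n T i) (pathLen n i j + 1) f := by
  have hL : pathLen n i j < n := ZMod.val_lt _
  refine and_congr ⟨fun h x hx => ?_, fun h k => ?_⟩ ⟨fun h t S hS hSt => ?_, fun h c hc => ?_⟩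
  · rw [Finset.mem_Ioo] at hx
    rw [mem_coordCell _ (by omega)]
    have := h ⟨x - 1, by omega⟩
    have hx1 : x - 1 + 1 = x := by omega
    simp only [hx1] at this
    rwa [add_assoc, add_comm (1 : ZMod n), ← Nat.cast_add_one, hx1] at this
  · have hk := k.2
    have := h (k + 1) (Finset.mem_Ioo.2 ⟨by omega, by omega⟩)
    rw [mem_coordCell _ (by omega)] at this
    rwa [add_assoc, add_comm (1 : ZMod n), ← Nat.cast_add_one]
  · refine le_trans ?_ (h t t.2)
    refine Finset.card_le_card_of_surjOn (fun k : Fin (pathLen n i j) => (k : ℕ) + 1)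
      fun x hx => ?_
    have hxS := Finset.mem_Ioo.1 (hS hx)
    have hx1 : x - 1 + 1 = x := by omega
    refine ⟨⟨x - 1, by omega⟩, ?_, hx1⟩
    simp [hx1, hSt x hx]
  · have hinj : Function.Injective fun k : Fin (pathLen n i j) => (k : ℕ) + 1 :=
      fun k l hkl => Fin.ext (Nat.succ_injective hkl)
    rw [← Finset.card_image_of_injective _ hinj]
    refine h ⟨c, hc⟩ _ (fun x hx => ?_) fun x hx => ?_
    · obtain ⟨k, -, rfl⟩ := Finset.mem_image.1 hx
      have hk := k.2
      exact Finset.mem_Ioo.2 ⟨by omega, by omega⟩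
    · obtain ⟨k, hk, rfl⟩ := Finset.mem_image.1 hx
      exact Subtype.ext (Finset.mem_filter.1 hk).2

/-- `d`-paths from `i` to `j` correspond to assignments in coordinates based at `i`. -/
def dPathEquiv [NeZero n] (d : ℕ) (T : Finset (Finset (ZMod n))) (i j : ZMod n)
    (g : ℕ → {c // c ∈ T}) :
    {q : Fin (pathLen n i j) → {c // c ∈ T} // IsDPath n d T i j q} ≃
      assignments d (coordCell n T i) g (pathLen n i j + 1) where
  toFun q := ⟨fun x => if h : 0 < x ∧ x - 1 < pathLen n i j then q.1 ⟨x - 1, h.2⟩ else g x,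
    by
      refine (isDPath_iff_isAssignment _ j).1 ?_
      convert q.2 with k
      simp, fun x hx => dif_neg fun h => hx (Finset.mem_Ioo.2 ⟨h.1, by omega⟩)⟩
  invFun f := ⟨fun k => f.1 (k + 1), (isDPath_iff_isAssignment _ j).2 f.2.1⟩
  left_inv q := by
    ext k
    simp
  right_inv f := by
    refine Subtype.ext (funext fun x => ?_)
    by_cases h : 0 < x ∧ x - 1 < pathLen n i j
    · simp only [h, and_self, dite_true]
      rw [Nat.sub_add_cancel h.1]
    · simp only [h, dite_false]
      exact (f.2.2 x fun hm => h (by rw [Finset.mem_Ioo] at hm; omega)).symm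

theorem dPathCount_eq_ncard [NeZero n] (g : ℕ → {c // c ∈ T}) (j : ZMod n) :
    dPathCount n d T i j = (assignments d (coordCell n T i) g (pathLen n i j + 1)).ncard := by
  rw [dPathCount, Nat.card_congr (dPathEquiv d T i j g), Nat.card_coe_set_eq]

theorem finite_assignments [NeZero n] (g : ℕ → {c // c ∈ T}) (j : ZMod n) :
    (assignments d (coordCell n T i) g (pathLen n i j + 1)).Finite :=
  Set.finite_coe_iff.1 (Finite.of_equiv _ (dPathEquiv d T i j g))

/-- If `v` lies on the arc from `k` to `ℓ` and `i ≠ ℓ` lies on the complementary arc,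
then in coordinates based at `i` the vertex `v` lies between `k` and `ℓ`. -/
theorem val_sub_between [NeZero n] {k ℓ v : ZMod n} (hiℓ : i ≠ ℓ)
    (hv : InArc n k ℓ v) (hi : InArc n ℓ k i) :
    (k - i).val ≤ (v - i).val ∧ (v - i).val ≤ (ℓ - i).val := by
  have e1 := zmod_val_sub_eq_ite (v - i) (k - i)
  have e2 := zmod_val_sub_eq_ite (ℓ - i) (k - i)
  have e3 := zmod_val_sub_eq_ite (i - i) (ℓ - i)
  have e4 := zmod_val_sub_eq_ite (k - i) (ℓ - i)
  simp only [sub_sub_sub_cancel_right] at e1 e2 e3 e4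
  have hk := (k - i).val_lt
  have hℓ := (ℓ - i).val_lt
  have hv' := (v - i).val_lt
  have hℓ0 : (ℓ - i).val ≠ 0 := by
    rw [Ne, ZMod.val_eq_zero, sub_eq_zero]; exact hiℓ.symm
  have h0 : (i - i).val = 0 := by rw [sub_self, ZMod.val_zero]
  unfold InArc at hv hi
  rw [e1, e2] at hv
  rw [e3, e4, h0] at hi
  split_ifs at hv hi <;> omega

end Coordinates

/-- The `d`-path numbers `m_{i,j}` of a `d`-angulation `T` satisfy the recurrences
defining the numbers `m̃_{i,j}`:  `m_{i,i} = 0`; `m_{i,j} = 1` whenever `i` and `j`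
lie on a common `d`-gon; and whenever `k, ℓ` are vertices of a `d`-gon `c` of `T`
such that the chord `k ℓ` separates `c` from `i` (all vertices of `c` lie on the
counterclockwise arc from `k` to `ℓ` while `i` lies on the complementary arc),
every other vertex `v` of `c` satisfies `m_{i,v} = m_{i,k} + m_{i,ℓ}`.
Hence the inductively defined numbers `m̃_{i,j}` equal the `d`-path counts. -/
theorem dPathCount_eq_tilde (d m n : ℕ) (hd : 3 ≤ d) (hn : n = d + m * (d - 2))
    (T : Finset (Finset (ZMod n))) (hT : IsDAngulation n d T) (i : ZMod n) :
    dPathCount n d T i i = 0 ∧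
    (∀ j : ZMod n, j ≠ i → (∃ c ∈ T, i ∈ c ∧ j ∈ c) → dPathCount n d T i j = 1) ∧
    ∀ c ∈ T, ∀ k ∈ c, ∀ ℓ ∈ c, k ≠ ℓ →
      (∀ v ∈ c, InArc n k ℓ v) → InArc n ℓ k i →
      ∀ v ∈ c, v ≠ k → v ≠ ℓ →
        dPathCount n d T i v = dPathCount n d T i k + dPathCount n d T i ℓ := by
  have hn3 : 3 ≤ n := by rw [hn]; exact hd.trans (Nat.le_add_right _ _)
  have : NeZero n := ⟨by omega⟩
  have h := hT.isNoncrossing hd hn3 i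
  obtain ⟨g, hg⟩ := h.exists_inner_cell
  have hself : dPathCount n d T i i = 0 := by
    rw [dPathCount_eq_ncard g, pathLen_self (by omega), h.assignments_self_eq_empty hg (by omega),
      Set.ncard_empty]
  have hone : ∀ j : ZMod n, j ≠ i → (∃ c ∈ T, i ∈ c ∧ j ∈ c) → dPathCount n d T i j = 1 := by
    rintro j hj ⟨c, hc, hic, hjc⟩
    have h0 := val_sub_mem_coordCell (i := i) ⟨c, hc⟩ hic
    rw [sub_self, ZMod.val_zero] at h0
    rw [dPathCount_eq_ncard g, pathLen_of_ne (by omega) hj,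
      h.assignments_eq_singleton hg h0 (val_sub_mem_coordCell ⟨c, hc⟩ hjc), Set.ncard_singleton]
  refine ⟨hself, hone, fun c hc k hk ℓ hℓ hkℓ harc hi v hv hvk hvℓ => ?_⟩
  by_cases hik : i = k
  · subst hik
    rw [hself, hone v hvk ⟨c, hc, hk, hv⟩, hone ℓ hkℓ.symm ⟨c, hc, hk, hℓ⟩]
  by_cases hiℓ : i = ℓ
  · subst hiℓ
    rw [hself, hone v hvℓ ⟨c, hc, hℓ, hv⟩, hone k hkℓ ⟨c, hc, hℓ, hk⟩]
  have hbetween : ∀ w ∈ c, (k - i).val ≤ (w - i).val ∧ (w - i).val ≤ (ℓ - i).val :=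
    fun w hw => val_sub_between hiℓ (harc w hw) hi
  have hinj := injective_val_sub i
  have hkv : (k - i).val ≠ (v - i).val := fun e => hvk (hinj e).symm
  have hvl : (v - i).val ≠ (ℓ - i).val := fun e => hvℓ (hinj e)
  have hk0 : (k - i).val ≠ 0 := by
    rw [Ne, ZMod.val_eq_zero, sub_eq_zero]; exact Ne.symm hik
  have hvi : v ≠ i := by
    rintro rfl
    have := (hbetween v hv).1
    rw [sub_self, ZMod.val_zero] at this
    omega
  have hfin := finite_assignments (d := d) (i := i) g v
  obtain ⟨h1, h2⟩ := hbetween v hv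
  rw [dPathCount_eq_ncard g, dPathCount_eq_ncard g, dPathCount_eq_ncard g]
  rw [pathLen_of_ne (by omega) hvi] at hfin ⊢
  rw [pathLen_of_ne (by omega) (Ne.symm hik), pathLen_of_ne (by omega) (Ne.symm hiℓ)]
  refine h.ncard_assignments_add hg (c := ⟨c, hc⟩) (val_sub_mem_coordCell _ hk)
    (val_sub_mem_coordCell _ hv) (val_sub_mem_coordCell _ hℓ) (by omega) (by omega) (by omega)
    (fun x hx => ?_) hfin
  obtain ⟨w, hw, rfl⟩ := Finset.mem_image.1 hx
  exact hbetween w hw
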